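/- arXiv:1811.02502 — 11 statements merged into one kernel-verified Lean document; each statement's English description precedes it below -/
import Mathlib

section
/- If V = (v_1,…,v_N) ∈ 𝒱 is nondecreasing, then the increments Δ_k = w_k(V) − v_k satisfy Δ_{k+1} ≥ Δ_k for all k = 1,…,N−1. -/
open Finset Filter

/-- `J ε V k` is the set of indices `l` whose opinions are `ε`-close to `V k`. -/
noncomputable def J {N : ℕ} (ε : ℝ) (V : Fin N → ℝ) (k : Fin N) : Finset (Fin N) :=
  Finset.univ.filter (fun l => |V l - V k| ≤ ε)

/-- `w h ε V k = v_k + (h / I(v_k)) · Σ_{l ∈ J(v_k)} v_l`. -/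
noncomputable def w {N : ℕ} (h ε : ℝ) (V : Fin N → ℝ) (k : Fin N) : ℝ :=
  V k + (h / (J ε V k).card) * ∑ l ∈ J ε V k, V l

/-- The opinion-dynamics operator `Φ`, obtained from `w` by cutting at `±1`. -/
noncomputable def Phi {N : ℕ} (h ε : ℝ) (V : Fin N → ℝ) : Fin N → ℝ :=
  fun k => max (-1) (min 1 (w h ε V k))

/-- The metric `ρ(V, V') = max_k |v_k − v'_k|` on `𝒱`. -/
noncomputable def rho {N : ℕ} (V V' : Fin N → ℝ) : ℝ := ⨆ k, |V k - V' k|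

/-- If `f x ≤ f y` for all `x ∈ A`, `y ∈ B` that do not both lie in `A ∩ B`, then the mean of `f`
over `A` is at most its mean over `B` (with denominators cleared). -/
lemma card_mul_sum_le_card_mul_sum {ι : Type*} [DecidableEq ι] (A B : Finset ι) (f : ι → ℝ)
    (hf : ∀ x ∈ A, ∀ y ∈ B, (x ∈ B → y ∉ A) → f x ≤ f y) :
    (B.card : ℝ) * ∑ x ∈ A, f x ≤ (A.card : ℝ) * ∑ y ∈ B, f y := by
  have hsum (S T : Finset ι) : ∑ p ∈ S ×ˢ T, (f p.2 - f p.1) =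
      (S.card : ℝ) * ∑ y ∈ T, f y - (T.card : ℝ) * ∑ x ∈ S, f x := by
    rw [Finset.sum_product]
    simp [Finset.sum_sub_distrib, Finset.mul_sum]
  have hle : ∑ p ∈ (A ∩ B) ×ˢ (A ∩ B), (f p.2 - f p.1) ≤ ∑ p ∈ A ×ˢ B, (f p.2 - f p.1) := by
    refine Finset.sum_le_sum_of_subset_of_nonneg
      (Finset.product_subset_product Finset.inter_subset_left Finset.inter_subset_right) ?_
    rintro ⟨x, y⟩ hp hq
    simp only [Finset.mem_product, Finset.mem_inter] at hp hq
    exact sub_nonneg.2 (hf x hp.1 y hp.2 fun hx hy => hq ⟨⟨hp.1, hx⟩, hy, hp.2⟩)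
  rw [hsum, hsum] at hle
  linarith

/-- The mean opinion over the `ε`-neighbourhood of an index is monotone in its opinion. -/
lemma sum_J_div_card_le {N : ℕ} {ε : ℝ} (hε : 0 ≤ ε) (V : Fin N → ℝ) {i j : Fin N}
    (hij : V i ≤ V j) :
    (∑ l ∈ J ε V i, V l) / (J ε V i).card ≤ (∑ l ∈ J ε V j, V l) / (J ε V j).card := by
  have hpos (k : Fin N) : (0 : ℝ) < (J ε V k).card :=
    Nat.cast_pos.2 (Finset.card_pos.2 ⟨k, by simp [J, hε]⟩)
  rw [div_le_div_iff₀ (hpos i) (hpos j), mul_comm, mul_comm (∑ l ∈ J ε V j, V l)]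
  refine card_mul_sum_le_card_mul_sum _ _ V fun x hx y hy hxy => ?_
  simp only [J, Finset.mem_filter, Finset.mem_univ, true_and, abs_le] at hx hy hxy
  by_contra! hlt
  exact hxy ⟨by linarith, by linarith⟩ ⟨by linarith, by linarith⟩

/-- if `V ∈ 𝒱` is nondecreasing, then the increments
`Δ_k = w_k(V) − v_k` satisfy `Δ_{k+1} ≥ Δ_k` for `k = 1,…,N−1`. -/
theorem statement1 (N : ℕ) (hN : 1 ≤ N) (h ε : ℝ)
    (hh : h ∈ Set.Ioo (0 : ℝ) 1) (hε : ε ∈ Set.Ioo (0 : ℝ) 1)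
    (V : Fin N → ℝ) (hV : ∀ k, V k ∈ Set.Icc (-1 : ℝ) 1) (hmono : Monotone V)
    (k : ℕ) (hk : k + 1 < N) :
    w h ε V ⟨k, Nat.lt_of_succ_lt hk⟩ - V ⟨k, Nat.lt_of_succ_lt hk⟩ ≤
      w h ε V ⟨k + 1, hk⟩ - V ⟨k + 1, hk⟩ := by
  have hle : V ⟨k, Nat.lt_of_succ_lt hk⟩ ≤ V ⟨k + 1, hk⟩ := hmono (Fin.mk_le_mk.2 k.le_succ)
  simpa only [w, add_sub_cancel_left, div_mul_eq_mul_div, mul_div_assoc] using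
    mul_le_mul_of_nonneg_left (sum_J_div_card_le hε.1.le V hle) hh.1.le
end

section
/- If the initial array V^0 ∈ 𝒱 is nondecreasing, then for every n ≥ 0 the array V^n = Φ^n(V^0) is nondecreasing. -/
open Finset Filter

/-- If every value on `s` is at most every value on `t`, the same holds for the averages. -/
theorem card_mul_sum_le_card_mul_sum_s2 {ι : Type*} (f : ι → ℝ) (s t : Finset ι)
    (hst : ∀ a ∈ s, ∀ b ∈ t, f a ≤ f b) :
    (t.card : ℝ) * ∑ a ∈ s, f a ≤ s.card * ∑ b ∈ t, f b := by
  have key : ∑ a ∈ s, ∑ _b ∈ t, f a ≤ ∑ _a ∈ s, ∑ b ∈ t, f b :=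
    Finset.sum_le_sum fun a ha => Finset.sum_le_sum fun b hb => hst a ha b hb
  simpa [Finset.mul_sum] using key

theorem card_J_pos {N : ℕ} {ε : ℝ} (hε : 0 ≤ ε) (V : Fin N → ℝ) (k : Fin N) :
    0 < (J ε V k).card :=
  Finset.card_pos.mpr ⟨k, by simpa [J] using hε⟩

/-- The average opinion in an `ε`-neighbourhood is nondecreasing in its centre. -/
theorem card_J_mul_sum_le {N : ℕ} (ε : ℝ) (V : Fin N → ℝ) {i j : Fin N} (hij : V i ≤ V j) :
    ((J ε V j).card : ℝ) * ∑ l ∈ J ε V i, V l ≤ (J ε V i).card * ∑ l ∈ J ε V j, V l := by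
  set A := J ε V i \ J ε V j with hA
  set B := J ε V i ∩ J ε V j with hB
  set C := J ε V j \ J ε V i with hC
  have hAB := card_mul_sum_le_card_mul_sum_s2 V A B (by
    intro a ha b hb
    simp only [hA, hB, J, Finset.mem_sdiff, mem_inter, mem_filter, mem_univ, true_and, abs_le] at ha hb
    grind)
  have hAC := card_mul_sum_le_card_mul_sum_s2 V A C (by
    intro a ha b hb
    simp only [hA, hC, J, Finset.mem_sdiff, mem_filter, mem_univ, true_and, abs_le] at ha hb
    grind)
  have hBC := card_mul_sum_le_card_mul_sum_s2 V B C (by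
    intro a ha b hb
    simp only [hB, hC, J, Finset.mem_sdiff, mem_inter, mem_filter, mem_univ, true_and, abs_le] at ha hb
    grind)
  have hsi : ∑ l ∈ B, V l + ∑ l ∈ A, V l = ∑ l ∈ J ε V i, V l :=
    Finset.sum_inter_add_sum_sdiff _ _ _
  have hsj : ∑ l ∈ B, V l + ∑ l ∈ C, V l = ∑ l ∈ J ε V j, V l := by
    rw [hB, Finset.inter_comm]
    exact Finset.sum_inter_add_sum_sdiff _ _ _
  have hci : (B.card : ℝ) + A.card = (J ε V i).card := by
    exact_mod_cast Finset.card_inter_add_card_sdiff _ _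
  have hcj : (B.card : ℝ) + C.card = (J ε V j).card := by
    rw [hB, Finset.inter_comm]
    exact_mod_cast Finset.card_inter_add_card_sdiff _ _
  rw [← hsi, ← hsj, ← hci, ← hcj]
  linarith

theorem w_le_w {N : ℕ} {h ε : ℝ} (hh : 0 ≤ h) (hε : 0 ≤ ε) (V : Fin N → ℝ) {i j : Fin N}
    (hij : V i ≤ V j) : w h ε V i ≤ w h ε V j := by
  have hi : (0 : ℝ) < (J ε V i).card := by exact_mod_cast card_J_pos hε V i
  have hj : (0 : ℝ) < (J ε V j).card := by exact_mod_cast card_J_pos hε V j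
  have key : (∑ l ∈ J ε V i, V l) / (J ε V i).card ≤ (∑ l ∈ J ε V j, V l) / (J ε V j).card := by
    rw [div_le_div_iff₀ hi hj]
    linarith [card_J_mul_sum_le ε V hij]
  unfold w
  rw [div_mul_eq_mul_div, div_mul_eq_mul_div, mul_div_assoc, mul_div_assoc]
  exact add_le_add hij (mul_le_mul_of_nonneg_left key hh)

theorem monotone_Phi {N : ℕ} {h ε : ℝ} (hh : 0 ≤ h) (hε : 0 ≤ ε) {V : Fin N → ℝ}
    (hV : Monotone V) : Monotone (Phi h ε V) := fun _ _ hij =>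
  max_le_max le_rfl (min_le_min le_rfl (w_le_w hh hε V (hV hij)))

/-- if the initial array `V⁰ ∈ 𝒱` is nondecreasing, then every
iterate `Vⁿ = Φⁿ(V⁰)` is nondecreasing. -/
theorem statement2 (N : ℕ) (hN : 1 ≤ N) (h ε : ℝ)
    (hh : h ∈ Set.Ioo (0 : ℝ) 1) (hε : ε ∈ Set.Ioo (0 : ℝ) 1)
    (V0 : Fin N → ℝ) (hV0 : ∀ k, V0 k ∈ Set.Icc (-1 : ℝ) 1) (hmono : Monotone V0)
    (n : ℕ) :
    Monotone ((Phi h ε)^[n] V0) := by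
  induction n with
  | zero => exact hmono
  | succ n ih =>
    rw [Function.iterate_succ_apply']
    exact monotone_Phi hh.1.le hε.1.le ih
end

section
/- For any V^0 ∈ 𝒱, if the k-th component of V^n = Φ^n(V^0) equals 1, then the k-th component of V^m equals 1 for every m > n. Symmetrically, if the k-th component of V^n equals −1, then the k-th component of V^m equals −1 for every m > n. -/
open Finset Filter

theorem Phi_eq_one {N : ℕ} {h ε : ℝ} (hh : 0 ≤ h) (hε : ε ≤ 1) {V : Fin N → ℝ} {k : Fin N}
    (hk : V k = 1) : Phi h ε V k = 1 := by
  have hs : 0 ≤ ∑ l ∈ J ε V k, V l := Finset.sum_nonneg fun l hl => by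
    have hl' := (abs_le.mp (Finset.mem_filter.mp hl).2).1
    linarith
  have hw : 1 ≤ w h ε V k := by
    have : 0 ≤ (h / (J ε V k).card) * ∑ l ∈ J ε V k, V l := by positivity
    unfold w
    linarith
  simp [Phi, min_eq_left hw]

theorem Phi_eq_neg_one {N : ℕ} {h ε : ℝ} (hh : 0 ≤ h) (hε : ε ≤ 1) {V : Fin N → ℝ} {k : Fin N}
    (hk : V k = -1) : Phi h ε V k = -1 := by
  have hs : ∑ l ∈ J ε V k, V l ≤ 0 := Finset.sum_nonpos fun l hl => by
    have hl' := (abs_le.mp (Finset.mem_filter.mp hl).2).2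
    linarith
  have hw : w h ε V k ≤ -1 := by
    have : (h / (J ε V k).card) * ∑ l ∈ J ε V k, V l ≤ 0 :=
      mul_nonpos_of_nonneg_of_nonpos (by positivity) hs
    unfold w
    linarith
  exact max_eq_left ((min_le_right _ _).trans hw)

/-- A coordinate value preserved by one step of a map is preserved by all later iterates. -/
theorem iterate_apply_eq_of_le {ι α : Type*} {f : (ι → α) → ι → α} {k : ι} {c : α}
    (hf : ∀ V, V k = c → f V k = c) {V : ι → α} {n m : ℕ} (hn : f^[n] V k = c) (hnm : n ≤ m) :
    f^[m] V k = c := by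
  induction m, hnm using Nat.le_induction with
  | base => exact hn
  | succ m _ ih =>
    rw [Function.iterate_succ_apply']
    exact hf _ ih

/-- for any `V⁰ ∈ 𝒱`, if the `k`-th component of `Vⁿ = Φⁿ(V⁰)`
equals `1`, then the `k`-th component of `Vᵐ` equals `1` for every `m > n`;
symmetrically for `−1`. -/
theorem statement4 (N : ℕ) (hN : 1 ≤ N) (h ε : ℝ)
    (hh : h ∈ Set.Ioo (0 : ℝ) 1) (hε : ε ∈ Set.Ioo (0 : ℝ) 1)
    (V0 : Fin N → ℝ) (hV0 : ∀ k, V0 k ∈ Set.Icc (-1 : ℝ) 1) :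
    (∀ n m : ℕ, ∀ k : Fin N,
        ((Phi h ε)^[n] V0) k = 1 → n < m → ((Phi h ε)^[m] V0) k = 1) ∧
      (∀ n m : ℕ, ∀ k : Fin N,
        ((Phi h ε)^[n] V0) k = -1 → n < m → ((Phi h ε)^[m] V0) k = -1) := by
  exact ⟨fun _ _ _ hn hnm =>
      iterate_apply_eq_of_le (fun _ => Phi_eq_one hh.1.le hε.2.le) hn hnm.le,
    fun _ _ _ hn hnm =>
      iterate_apply_eq_of_le (fun _ => Phi_eq_neg_one hh.1.le hε.2.le) hn hnm.le⟩
end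

section
/- If V^0 ∈ 𝒱 has k-th component v_k^0 ≥ ε, then there exists n_0 ≥ 0 such that the k-th component of Φ^n(V^0) equals 1 for all n ≥ n_0. -/
open Finset Filter

/-- If `ε ≤ V k`, every opinion that `k` takes into account is nonnegative, so `w` exceeds `V k`
by a fixed positive amount. -/
lemma add_le_w_of_le {N : ℕ} {h ε : ℝ} (hh : 0 ≤ h) (hε : 0 ≤ ε) {V : Fin N → ℝ} {k : Fin N}
    (hk : ε ≤ V k) : V k + h / N * ε ≤ w h ε V k := by
  have hkJ : k ∈ J ε V k := by simp [J, hε]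
  have hnonneg : ∀ l ∈ J ε V k, 0 ≤ V l := by
    intro l hl
    have hl' : |V l - V k| ≤ ε := by simpa [J] using hl
    linarith [(abs_le.mp hl').1]
  have hsum : ε ≤ ∑ l ∈ J ε V k, V l := hk.trans (Finset.single_le_sum hnonneg hkJ)
  have hpos : (0 : ℝ) < (J ε V k).card := by exact_mod_cast Finset.card_pos.mpr ⟨k, hkJ⟩
  have hcard : ((J ε V k).card : ℝ) ≤ N := by
    exact_mod_cast (Finset.card_le_univ (J ε V k)).trans_eq (Fintype.card_fin N)
  unfold w
  gcongr

lemma Phi_le_one {N : ℕ} (h ε : ℝ) (V : Fin N → ℝ) (k : Fin N) : Phi h ε V k ≤ 1 :=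
  max_le (by norm_num) (min_le_left _ _)

lemma min_le_iterate_Phi {N : ℕ} {h ε : ℝ} (hh : 0 ≤ h) (hε : 0 ≤ ε) (hε1 : ε ≤ 1)
    {V : Fin N → ℝ} {k : Fin N} (hk : ε ≤ V k) (n : ℕ) :
    min 1 (ε + n * (h / N * ε)) ≤ ((Phi h ε)^[n] V) k := by
  have hc : 0 ≤ h / N * ε := by positivity
  induction n with
  | zero => simp [hk]
  | succ n ih =>
    rw [Function.iterate_succ_apply']
    have hge : ε ≤ ((Phi h ε)^[n] V) k :=
      (le_min hε1 (le_add_of_nonneg_right (by positivity))).trans ih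
    have hw := add_le_w_of_le hh hε hge
    refine le_trans (le_min (min_le_left _ _) ?_) (le_max_right _ _)
    refine le_trans ?_ hw
    push_cast
    rcases min_le_iff.mp ih with h1 | h1
    · exact (min_le_left _ _).trans (by linarith)
    · exact (min_le_right _ _).trans (by linarith)

/-- if `V⁰ ∈ 𝒱` has `v⁰_k ≥ ε`, then there exists `n₀ ≥ 0` such
that the `k`-th component of `Φⁿ(V⁰)` equals `1` for all `n ≥ n₀`. -/
theorem statement6 (N : ℕ) (hN : 1 ≤ N) (h ε : ℝ)
    (hh : h ∈ Set.Ioo (0 : ℝ) 1) (hε : ε ∈ Set.Ioo (0 : ℝ) 1)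
    (V0 : Fin N → ℝ) (hV0 : ∀ k, V0 k ∈ Set.Icc (-1 : ℝ) 1)
    (k : Fin N) (hk : ε ≤ V0 k) :
    ∃ n0 : ℕ, ∀ n ≥ n0, ((Phi h ε)^[n] V0) k = 1 := by
  obtain ⟨h0, -⟩ := hh
  obtain ⟨ε0, ε1⟩ := hε
  have hN0 : (0 : ℝ) < N := by exact_mod_cast hN
  have hc : 0 < h / N * ε := by positivity
  obtain ⟨m, hm⟩ := exists_nat_ge (1 / (h / N * ε))
  rw [div_le_iff₀ hc] at hm
  refine ⟨m, fun n hn => le_antisymm ?_ ?_⟩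
  · cases n with
    | zero => exact (hV0 k).2
    | succ n =>
      rw [Function.iterate_succ_apply']
      exact Phi_le_one h ε _ k
  · have hmn : (m : ℝ) * (h / N * ε) ≤ n * (h / N * ε) := by gcongr
    exact (le_min le_rfl (by linarith)).trans (min_le_iterate_Phi h0.le ε0.le ε1.le hk n)
end

section
/- If V^0 ∈ 𝒱 has k-th component v_k^0 ≤ −ε, then there exists n_0 ≥ 0 such that the k-th component of Φ^n(V^0) equals −1 for all n ≥ n_0. -/
open Finset Filter

/-- An opinion at most `-ε` only sees nonpositive opinions, so it decreases by at least `h ε / N`. -/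
theorem w_le_sub {N : ℕ} {h ε : ℝ} (hh : 0 ≤ h) (hε : 0 ≤ ε) (V : Fin N → ℝ) (k : Fin N)
    (hk : V k ≤ -ε) : w h ε V k ≤ V k - h * ε / N := by
  have hmem : k ∈ J ε V k := by simp [J, hε]
  have hsum : ∑ l ∈ J ε V k, V l ≤ -ε := by
    rw [← Finset.add_sum_erase _ _ hmem]
    have hrest : ∑ l ∈ (J ε V k).erase k, V l ≤ 0 := by
      refine Finset.sum_nonpos fun l hl => ?_
      have hl' : |V l - V k| ≤ ε := (Finset.mem_filter.mp (Finset.mem_of_mem_erase hl)).2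
      linarith [(abs_le.mp hl').2]
    linarith
  have hpos : (0 : ℝ) < (J ε V k).card := by
    exact_mod_cast Finset.card_pos.mpr ⟨k, hmem⟩
  have hcard : ((J ε V k).card : ℝ) ≤ N := by
    exact_mod_cast (Finset.card_le_univ (J ε V k)).trans_eq (Fintype.card_fin N)
  have hdiv : h / N ≤ h / (J ε V k).card := by gcongr
  have hmul : h / (J ε V k).card * ∑ l ∈ J ε V k, V l ≤ h / (J ε V k).card * (-ε) := by
    gcongr
  have hmul' : h / N * ε ≤ h / (J ε V k).card * ε := by gcongr
  rw [w, mul_div_right_comm]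
  linarith

/-- Below `-ε`, the iterates of `Φ` descend linearly until they are cut at `-1`. -/
theorem iterate_Phi_le_max {N : ℕ} {h ε : ℝ} (hh : 0 ≤ h) (hε : 0 ≤ ε) (hε1 : ε ≤ 1)
    (V : Fin N → ℝ) (k : Fin N) (hk : V k ≤ -ε) (n : ℕ) :
    ((Phi h ε)^[n] V) k ≤ max (-1) (-ε - n * (h * ε / N)) := by
  have hc : 0 ≤ h * ε / N := by positivity
  induction n with
  | zero => simp [hk]
  | succ n ih =>
    rw [Function.iterate_succ_apply']
    have hn : 0 ≤ n * (h * ε / N) := by positivity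
    have hstep := w_le_sub hh hε _ k (ih.trans (max_le (by linarith) (by linarith)))
    refine max_le (le_max_left _ _) ((min_le_right _ _).trans (hstep.trans ?_))
    push_cast
    rcases le_max_iff.mp ih with h1 | h1
    · exact le_max_of_le_left (by linarith)
    · exact le_max_of_le_right (by linarith)

/-- if `V⁰ ∈ 𝒱` has `v⁰_k ≤ −ε`, then there exists `n₀ ≥ 0` such
that the `k`-th component of `Φⁿ(V⁰)` equals `−1` for all `n ≥ n₀`. -/
theorem statement7 (N : ℕ) (hN : 1 ≤ N) (h ε : ℝ)
    (hh : h ∈ Set.Ioo (0 : ℝ) 1) (hε : ε ∈ Set.Ioo (0 : ℝ) 1)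
    (V0 : Fin N → ℝ) (hV0 : ∀ k, V0 k ∈ Set.Icc (-1 : ℝ) 1)
    (k : Fin N) (hk : V0 k ≤ -ε) :
    ∃ n0 : ℕ, ∀ n ≥ n0, ((Phi h ε)^[n] V0) k = -1 := by
  obtain ⟨hh0, -⟩ := hh
  obtain ⟨hε0, hε1⟩ := hε
  have hN0 : (0 : ℝ) < N := by exact_mod_cast hN
  have hc : 0 < h * ε / N := by positivity
  obtain ⟨m, hm⟩ := exists_nat_ge (1 / (h * ε / N))
  rw [div_le_iff₀ hc] at hm
  refine ⟨m + 1, fun n hn => le_antisymm ?_ ?_⟩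
  · refine (iterate_Phi_le_max hh0.le hε0.le hε1.le V0 k hk n).trans (max_le le_rfl ?_)
    have hmn : (m : ℝ) ≤ n := by exact_mod_cast (Nat.le_succ m).trans hn
    linarith [mul_le_mul_of_nonneg_right hmn hc.le]
  · obtain ⟨p, rfl⟩ := Nat.exists_eq_add_of_le' hn
    rw [← add_assoc, Function.iterate_succ_apply']
    exact le_max_left _ _
end

section
/- Let P be a basic fixed point. If V^0 ∈ 𝒱 satisfies ρ(V^0, P) ≤ 1 − ε, then there exists n_0 such that Φ^n(V^0) = P for all n ≥ n_0. -/
open Finset Filter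

/-- If all opinions have absolute value at least `ε`, the `ε`-close ones share their sign. -/
theorem eq_of_mem_J {N : ℕ} {ε : ℝ} {P V : Fin N → ℝ} (hε : 0 < ε)
    (hP : ∀ k, P k = -1 ∨ P k = 1) (hV : ∀ k, ε ≤ P k * V k) {k l : Fin N}
    (hl : l ∈ J ε V k) : P l = P k := by
  have habs : |V l - V k| ≤ ε := by simpa [J] using hl
  obtain ⟨h1, h2⟩ := abs_le.mp habs
  have hk := hV k
  have hl' := hV l
  rcases hP k with hk' | hk' <;> rcases hP l with hl'' | hl'' <;>
    rw [hk'] at hk <;> rw [hl''] at hl' <;> linarith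

theorem add_mul_le_mul_w {N : ℕ} {h ε c : ℝ} {P V : Fin N → ℝ} (hh : 0 < h) (hε : 0 < ε)
    (hP : ∀ k, P k = -1 ∨ P k = 1) (hV : ∀ k, ε ≤ P k * V k) {k : Fin N}
    (hc : c ≤ P k * V k) : c + h * ε ≤ P k * w h ε V k := by
  have hcard : (0 : ℝ) < (J ε V k).card := by
    have : k ∈ J ε V k := by simp [J, hε.le]
    exact_mod_cast Finset.card_pos.mpr ⟨k, this⟩
  have hsum : (J ε V k).card * ε ≤ P k * ∑ l ∈ J ε V k, V l := by
    rw [Finset.mul_sum, ← nsmul_eq_mul]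
    refine Finset.card_nsmul_le_sum _ _ _ fun l hl => ?_
    rw [← eq_of_mem_J hε hP hV hl]
    exact hV l
  calc c + h * ε = c + h / (J ε V k).card * ((J ε V k).card * ε) := by field_simp
    _ ≤ P k * V k + h / (J ε V k).card * (P k * ∑ l ∈ J ε V k, V l) := by gcongr
    _ = P k * w h ε V k := by unfold w; ring

theorem Phi_mem_Icc {N : ℕ} (h ε : ℝ) (V : Fin N → ℝ) (k : Fin N) :
    Phi h ε V k ∈ Set.Icc (-1 : ℝ) 1 :=
  ⟨le_max_left _ _, max_le (by norm_num) (min_le_left _ _)⟩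

theorem min_one_le_mul_Phi {N : ℕ} {h ε c : ℝ} {P V : Fin N → ℝ} {k : Fin N}
    (hP : P k = -1 ∨ P k = 1) (hc : c ≤ P k * w h ε V k) :
    min 1 c ≤ P k * Phi h ε V k := by
  unfold Phi
  rcases hP with hk | hk <;> rw [hk] at hc ⊢
  · have : max (-1) (min 1 (w h ε V k)) ≤ max (-1) (-c) :=
      max_le_max_left _ ((min_le_right _ _).trans (by linarith))
    rw [max_neg_neg] at this
    linarith
  · rw [one_mul] at hc ⊢
    exact (min_le_min_left _ hc).trans (le_max_right _ _)

theorem min_one_le_mul_iterate_Phi {N : ℕ} {h ε : ℝ} {P V : Fin N → ℝ} (hh : 0 < h)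
    (hε : 0 < ε) (hε1 : ε ≤ 1) (hP : ∀ k, P k = -1 ∨ P k = 1) (hV : ∀ k, ε ≤ P k * V k)
    (n : ℕ) (k : Fin N) : min 1 (ε + n * (h * ε)) ≤ P k * (Phi h ε)^[n] V k := by
  induction n generalizing k with
  | zero => simpa using Or.inr (hV k)
  | succ n ih =>
    have hpos : 0 < h * ε := mul_pos hh hε
    have hge : ∀ k, ε ≤ P k * (Phi h ε)^[n] V k := fun k =>
      (le_min hε1 (le_add_of_nonneg_right (by positivity))).trans (ih k)
    rw [Function.iterate_succ_apply']
    refine le_trans (le_min (min_le_left _ _) ?_)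
      (min_one_le_mul_Phi (hP k) (add_mul_le_mul_w hh hε hP hge (ih k)))
    rw [min_add]
    refine min_le_min (by linarith) (le_of_eq ?_)
    push_cast
    ring

theorem abs_sub_le_rho {N : ℕ} (V V' : Fin N → ℝ) (k : Fin N) : |V k - V' k| ≤ rho V V' :=
  le_ciSup (f := fun k => |V k - V' k|) (Set.finite_range _).bddAbove k

/-- Theorem 1: let `P` be a basic fixed point. If `V⁰ ∈ 𝒱`
satisfies `ρ(V⁰, P) ≤ 1 − ε`, then there exists `n₀` such that `Φⁿ(V⁰) = P`
for all `n ≥ n₀`. -/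
theorem statement8 (N : ℕ) (hN : 1 ≤ N) (h ε : ℝ)
    (hh : h ∈ Set.Ioo (0 : ℝ) 1) (hε : ε ∈ Set.Ioo (0 : ℝ) 1)
    (P : Fin N → ℝ) (L : ℕ) (hL : L ≤ N)
    (hPneg : ∀ k : Fin N, (k : ℕ) < L → P k = -1)
    (hPpos : ∀ k : Fin N, L ≤ (k : ℕ) → P k = 1)
    (V0 : Fin N → ℝ) (hV0 : ∀ k, V0 k ∈ Set.Icc (-1 : ℝ) 1)
    (hclose : rho V0 P ≤ 1 - ε) :
    ∃ n0 : ℕ, ∀ n ≥ n0, (Phi h ε)^[n] V0 = P := by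
  obtain ⟨hh0, -⟩ := hh
  obtain ⟨hε0, hε1⟩ := hε
  have hP : ∀ k, P k = -1 ∨ P k = 1 := fun k =>
    (lt_or_ge (k : ℕ) L).imp (hPneg k) (hPpos k)
  have hV : ∀ k, ε ≤ P k * V0 k := fun k => by
    obtain ⟨h1, h2⟩ := abs_le.mp ((abs_sub_le_rho V0 P k).trans hclose)
    rcases hP k with hk | hk <;> rw [hk] at h1 h2 ⊢ <;> linarith
  have hpos : 0 < h * ε := mul_pos hh0 hε0
  obtain ⟨n0, hn0⟩ := exists_nat_ge (1 / (h * ε))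
  rw [div_le_iff₀ hpos] at hn0
  refine ⟨n0, fun n hn => funext fun k => ?_⟩
  have hlower := min_one_le_mul_iterate_Phi hh0 hε0 hε1.le hP hV n k
  have hn' : (n0 : ℝ) * (h * ε) ≤ n * (h * ε) := by gcongr
  rw [min_eq_left (by linarith)] at hlower
  have hmem : (Phi h ε)^[n] V0 k ∈ Set.Icc (-1 : ℝ) 1 := by
    cases n with
    | zero => exact hV0 k
    | succ n => rw [Function.iterate_succ_apply']; exact Phi_mem_Icc _ _ _ _
  obtain ⟨h1, h2⟩ := hmem
  rcases hP k with hk | hk <;> rw [hk] at hlower ⊢ <;> linarith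
end

section
/- Suppose V^0 ∈ 𝒱 is nondecreasing and there is an index L with 1 ≤ L < N such that v_1^0 ≤ … ≤ v_L^0 < 0 < v_{L+1}^0 ≤ … ≤ v_N^0 and v_{L+1}^0 − v_L^0 > ε. Then there exists a finite n such that Φ^n(V^0) = P, where P is the basic fixed point with p_k = −1 for k ≤ L and p_k = 1 for k > L. -/
open Finset Filter

lemma self_mem_J {N : ℕ} {ε : ℝ} (hε : 0 ≤ ε) (V : Fin N → ℝ) (k : Fin N) : k ∈ J ε V k := by
  simp [J, hε]

lemma le_w_of_forall_mem_J {N : ℕ} {h ε c : ℝ} (hh : 0 ≤ h) (hε : 0 ≤ ε) {V : Fin N → ℝ}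
    {k : Fin N} (hc : ∀ l ∈ J ε V k, c ≤ V l) : (1 + h) * c ≤ w h ε V k := by
  have hk := self_mem_J hε V k
  have hcard : (0 : ℝ) < (J ε V k).card := by exact_mod_cast Finset.card_pos.mpr ⟨k, hk⟩
  have hsum : (J ε V k).card * c ≤ ∑ l ∈ J ε V k, V l := by
    simpa using Finset.card_nsmul_le_sum _ _ _ hc
  have havg : h * c ≤ h / (J ε V k).card * ∑ l ∈ J ε V k, V l := by
    calc h * c = h / (J ε V k).card * ((J ε V k).card * c) := by field_simp
      _ ≤ _ := by gcongr
  have := hc k hk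
  unfold w
  linarith

lemma J_neg {N : ℕ} (ε : ℝ) (V : Fin N → ℝ) (k : Fin N) : J ε (-V) k = J ε V k := by
  ext l
  simp [J, abs_sub_comm, neg_add_eq_sub]

lemma w_neg {N : ℕ} (h ε : ℝ) (V : Fin N → ℝ) (k : Fin N) : w h ε (-V) k = -w h ε V k := by
  simp only [w, J_neg, Pi.neg_apply, Finset.sum_neg_distrib]
  ring

lemma w_le_of_forall_mem_J {N : ℕ} {h ε c : ℝ} (hh : 0 ≤ h) (hε : 0 ≤ ε) {V : Fin N → ℝ}
    {k : Fin N} (hc : ∀ l ∈ J ε V k, V l ≤ -c) : w h ε V k ≤ -((1 + h) * c) := by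
  have := le_w_of_forall_mem_J (V := -V) (k := k) (c := c) hh hε fun l hl => by
    have := hc l (J_neg ε V k ▸ hl)
    simp only [Pi.neg_apply]
    linarith
  rw [w_neg] at this
  linarith

/-- The entries of `V ∈ [-1, 1]^N` before position `L` are at most `-a`, the others at least `b`. -/
def Separated {N : ℕ} (L : ℕ) (a b : ℝ) (V : Fin N → ℝ) : Prop :=
  (∀ k, V k ∈ Set.Icc (-1 : ℝ) 1) ∧ (∀ k : Fin N, (k : ℕ) < L → V k ≤ -a) ∧
    ∀ k : Fin N, L ≤ (k : ℕ) → b ≤ V k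

lemma Separated.phi {N L : ℕ} {h ε a b : ℝ} (hh : 0 ≤ h) (hε : 0 ≤ ε) (hab : ε < a + b)
    {V : Fin N → ℝ} (hV : Separated L a b V) :
    Separated L (min 1 ((1 + h) * a)) (min 1 ((1 + h) * b)) (Phi h ε V) := by
  obtain ⟨-, hneg, hpos⟩ := hV
  refine ⟨fun k => ⟨le_max_left _ _, max_le (by norm_num) (min_le_left _ _)⟩,
    fun k hk => ?_, fun k hk => ?_⟩
  · have hw : w h ε V k ≤ -((1 + h) * a) := w_le_of_forall_mem_J hh hε fun l hl => by
      refine hneg l (lt_of_not_ge fun hl' => ?_)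
      have h₁ := (abs_le.mp (Finset.mem_filter.mp hl).2).2
      have h₂ := hneg k hk
      have h₃ := hpos l hl'
      linarith
    exact max_le (neg_le_neg (min_le_left _ _))
      ((min_le_right _ _).trans (hw.trans (neg_le_neg (min_le_right _ _))))
  · have hw : (1 + h) * b ≤ w h ε V k := le_w_of_forall_mem_J hh hε fun l hl => by
      refine hpos l (le_of_not_gt fun hl' => ?_)
      have h₁ := (abs_le.mp (Finset.mem_filter.mp hl).2).1
      have h₂ := hpos k hk
      have h₃ := hneg l hl'
      linarith
    exact (min_le_min_left 1 hw).trans (le_max_right _ _)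

lemma le_min_one_pow_mul {h a : ℝ} (hh : 0 ≤ h) (ha : 0 ≤ a) (ha1 : a ≤ 1) (n : ℕ) :
    a ≤ min 1 ((1 + h) ^ n * a) :=
  le_min ha1 (le_mul_of_one_le_left ha (one_le_pow₀ (by linarith)))

lemma min_one_mul_min_one {h x : ℝ} (hh : 0 ≤ h) :
    min 1 ((1 + h) * min 1 x) = min 1 ((1 + h) * x) := by
  rw [mul_min_of_nonneg _ _ (by linarith : 0 ≤ 1 + h), ← min_assoc, min_eq_left (a := (1 : ℝ))]
  linarith

lemma Separated.phi_iterate {N L : ℕ} {h ε a b : ℝ} (hh : 0 ≤ h) (hε : 0 ≤ ε)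
    (ha : 0 ≤ a) (ha1 : a ≤ 1) (hb : 0 ≤ b) (hb1 : b ≤ 1) (hab : ε < a + b)
    {V : Fin N → ℝ} (hV : Separated L a b V) (n : ℕ) :
    Separated L (min 1 ((1 + h) ^ n * a)) (min 1 ((1 + h) ^ n * b)) ((Phi h ε)^[n] V) := by
  induction n with
  | zero => simpa [ha1, hb1] using hV
  | succ n ih =>
    have := ih.phi hh hε (hab.trans_le (add_le_add (le_min_one_pow_mul hh ha ha1 n)
      (le_min_one_pow_mul hh hb hb1 n)))
    rwa [min_one_mul_min_one hh, min_one_mul_min_one hh, ← mul_assoc, ← mul_assoc, ← pow_succ',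
      ← Function.iterate_succ_apply' (Phi h ε)] at this

/-- Remark 1: suppose `V⁰ ∈ 𝒱` is nondecreasing, with
`v⁰_1 ≤ … ≤ v⁰_L < 0 < v⁰_{L+1} ≤ … ≤ v⁰_N` and `v⁰_{L+1} − v⁰_L > ε`
(`1 ≤ L < N`). Then there exists a finite `n` such that `Φⁿ(V⁰) = P`, where
`P` is the basic fixed point with `L` entries `−1` followed by entries `1`. -/
theorem statement9 (N : ℕ) (hN : 1 ≤ N) (h ε : ℝ)
    (hh : h ∈ Set.Ioo (0 : ℝ) 1) (hε : ε ∈ Set.Ioo (0 : ℝ) 1)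
    (V0 : Fin N → ℝ) (hV0 : ∀ k, V0 k ∈ Set.Icc (-1 : ℝ) 1) (hmono : Monotone V0)
    (L : ℕ) (hL1 : 1 ≤ L) (hL2 : L < N)
    (hneg : ∀ k : Fin N, (k : ℕ) < L → V0 k < 0)
    (hpos : ∀ k : Fin N, L ≤ (k : ℕ) → 0 < V0 k)
    (hgap : V0 ⟨L, hL2⟩ - V0 ⟨L - 1, by omega⟩ > ε)
    (P : Fin N → ℝ)
    (hPneg : ∀ k : Fin N, (k : ℕ) < L → P k = -1)
    (hPpos : ∀ k : Fin N, L ≤ (k : ℕ) → P k = 1) :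
    ∃ n : ℕ, (Phi h ε)^[n] V0 = P := by
  obtain ⟨hh, -⟩ := hh
  obtain ⟨hε, -⟩ := hε
  set a := -V0 ⟨L - 1, by omega⟩ with ha_def
  set b := V0 ⟨L, hL2⟩
  have ha : 0 < a := neg_pos.mpr (hneg _ (by simp only; omega))
  have hb : 0 < b := hpos _ le_rfl
  have ha1 : a ≤ 1 := by linarith [(hV0 ⟨L - 1, by omega⟩).1]
  have hb1 : b ≤ 1 := (hV0 _).2
  have hsep : Separated L a b V0 := by
    refine ⟨hV0, fun k hk => ?_, fun k hk => hmono (Fin.mk_le_of_le_val hk)⟩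
    rw [ha_def, neg_neg]
    exact hmono (Fin.le_def.mpr (by simp only; omega))
  obtain ⟨n, hn⟩ := pow_unbounded_of_one_lt (1 / min a b) (by linarith : 1 < 1 + h)
  have hn' : 1 ≤ (1 + h) ^ n * min a b := ((div_lt_iff₀ (lt_min ha hb)).mp hn).le
  have hna : 1 ≤ (1 + h) ^ n * a := hn'.trans (by gcongr; exact min_le_left _ _)
  have hnb : 1 ≤ (1 + h) ^ n * b := hn'.trans (by gcongr; exact min_le_right _ _)
  have hfin := hsep.phi_iterate hh.le hε.le ha.le ha1 hb.le hb1 (by linarith) n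
  rw [min_eq_left hna, min_eq_left hnb] at hfin
  obtain ⟨hmem, hfneg, hfpos⟩ := hfin
  refine ⟨n, funext fun k => ?_⟩
  rcases lt_or_ge (k : ℕ) L with hk | hk
  · rw [hPneg k hk]
    exact le_antisymm (hfneg k hk) (hmem k).1
  · rw [hPpos k hk]
    exact le_antisymm (hmem k).2 (hfpos k hk)
end

section
/- Suppose ε ≤ 1/2 and V ∈ 𝒱 is nondecreasing with |v_k| < ε for all k. Then the set of non-interacting pairs does not shrink under Φ: for all indices k, l, if |v_k − v_l| > ε then |Φ(V)_k − Φ(V)_l| > ε. -/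
open Finset Filter

/-- The sum over a sublevel set, rescaled by the total count, is at most the total sum rescaled by
the size of the sublevel set: the mean over a sublevel set is at most the overall mean. -/
theorem card_mul_sum_filter_le {ι : Type*} [Fintype ι] (f : ι → ℝ) (a : ℝ) :
    (Fintype.card ι : ℝ) * ∑ i with f i ≤ a, f i ≤
      ((univ.filter fun i => f i ≤ a).card : ℝ) * ∑ i, f i := by
  have hsum := sum_filter_add_sum_filter_not univ (fun i => f i ≤ a) f
  have hcard := card_filter_add_card_filter_not (s := (univ : Finset ι)) (fun i => f i ≤ a)
  have hlow : ∑ i with f i ≤ a, f i ≤ ((univ.filter fun i => f i ≤ a).card : ℝ) * a := by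
    simpa [nsmul_eq_mul] using
      sum_le_card_nsmul (univ.filter fun i => f i ≤ a) f a (fun i hi => (mem_filter.1 hi).2)
  have hhigh : ((univ.filter fun i => ¬ f i ≤ a).card : ℝ) * a ≤ ∑ i with ¬ f i ≤ a, f i := by
    simpa only [nsmul_eq_mul] using
      card_nsmul_le_sum (univ.filter fun i => ¬ f i ≤ a) f a
        (fun i hi => (not_le.1 (mem_filter.1 hi).2).le)
  rw [← card_univ, ← hsum, ← hcard]
  rw [Nat.cast_add]
  have h₁ := mul_le_mul_of_nonneg_left hlow
    (Nat.cast_nonneg (α := ℝ) (univ.filter fun i => ¬ f i ≤ a).card)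
  have h₂ := mul_le_mul_of_nonneg_left hhigh
    (Nat.cast_nonneg (α := ℝ) (univ.filter fun i => f i ≤ a).card)
  linarith

theorem J_card_pos {N : ℕ} {ε : ℝ} (hε : 0 ≤ ε) (V : Fin N → ℝ) (k : Fin N) :
    (0 : ℝ) < (J ε V k).card :=
  Nat.cast_pos.2 (card_pos.2 ⟨k, by simp [J, hε]⟩)

/-- The cut-off at `±1` is inactive when all opinions lie in `(-ε, ε)` with `ε ≤ 1 / 2`. -/
theorem Phi_eq_w {N : ℕ} {h ε : ℝ} (hh : h ∈ Set.Ioo (0 : ℝ) 1) (hε : 0 < ε) (hε2 : ε ≤ 1 / 2)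
    {V : Fin N → ℝ} (hV : ∀ k, |V k| < ε) (k : Fin N) : Phi h ε V k = w h ε V k := by
  have hpos := J_card_pos hε.le V k
  have hsum : |∑ l ∈ J ε V k, V l| ≤ (J ε V k).card * ε := by
    refine (abs_sum_le_sum_abs _ _).trans ?_
    simpa [nsmul_eq_mul] using
      sum_le_card_nsmul (J ε V k) (fun l => |V l|) ε (fun l _ => (hV l).le)
  have hdrift : |h / (J ε V k).card * ∑ l ∈ J ε V k, V l| ≤ ε := by
    rw [abs_mul, abs_of_pos (div_pos hh.1 hpos)]
    calc h / (J ε V k).card * |∑ l ∈ J ε V k, V l|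
        ≤ h / (J ε V k).card * ((J ε V k).card * ε) :=
          mul_le_mul_of_nonneg_left hsum (div_pos hh.1 hpos).le
      _ = h * ε := by field_simp
      _ ≤ ε := mul_le_of_le_one_left hε.le hh.2.le
  have hk := abs_lt.1 (hV k)
  have hd := abs_le.1 hdrift
  have hlo : -1 ≤ w h ε V k := by unfold w; linarith
  have hhi : w h ε V k ≤ 1 := by unfold w; linarith
  rw [Phi, min_eq_right hhi, max_eq_right hlo]

/-- The drift of an agent is at most that of a non-interacting agent to its right. -/
theorem drift_le_drift {N : ℕ} {h ε : ℝ} (hh : 0 ≤ h) (hε : 0 ≤ ε)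
    {V : Fin N → ℝ} (hV : ∀ k, |V k| < ε) {k l : Fin N} (hkl : ε < V l - V k) :
    h / (J ε V k).card * ∑ i ∈ J ε V k, V i ≤ h / (J ε V l).card * ∑ i ∈ J ε V l, V i := by
  have hk := abs_lt.1 (hV k)
  have hl := abs_lt.1 (hV l)
  have hJk : J ε V k = univ.filter fun i => V i ≤ V k + ε := by
    refine filter_congr fun i _ => ?_
    have hi := abs_lt.1 (hV i)
    rw [abs_le]
    constructor
    · rintro ⟨-, h₂⟩; linarith
    · intro h₁; constructor <;> linarith
  have hJl : J ε V l = univ.filter fun i => -V i ≤ ε - V l := by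
    refine filter_congr fun i _ => ?_
    have hi := abs_lt.1 (hV i)
    rw [abs_le]
    constructor
    · rintro ⟨h₁, -⟩; linarith
    · intro h₁; constructor <;> linarith
  have hpk := J_card_pos hε V k
  have hpl := J_card_pos hε V l
  have hlow := card_mul_sum_filter_le V (V k + ε)
  have hhigh := card_mul_sum_filter_le (fun i => -V i) (ε - V l)
  rw [← hJk] at hlow
  rw [← hJl, sum_neg_distrib, sum_neg_distrib] at hhigh
  have hN : (0 : ℝ) < Fintype.card (Fin N) := Nat.cast_pos.2 (Fintype.card_pos_iff.2 ⟨k⟩)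
  have hmk : (∑ i ∈ J ε V k, V i) / (J ε V k).card ≤ (∑ i, V i) / Fintype.card (Fin N) := by
    rw [div_le_div_iff₀ hpk hN]; linarith
  have hml : (∑ i, V i) / Fintype.card (Fin N) ≤ (∑ i ∈ J ε V l, V i) / (J ε V l).card := by
    rw [div_le_div_iff₀ hN hpl]; linarith
  rw [div_mul_eq_mul_div, div_mul_eq_mul_div, mul_div_assoc, mul_div_assoc]
  exact mul_le_mul_of_nonneg_left (hmk.trans hml) hh

/-- Lemma 4: suppose `ε ≤ 1/2` and `V ∈ 𝒱` is nondecreasing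
with `|v_k| < ε` for all `k`. Then non-interacting pairs stay non-interacting:
if `|v_k − v_l| > ε` then `|Φ(V)_k − Φ(V)_l| > ε`. -/
theorem statement13 (N : ℕ) (hN : 1 ≤ N) (h ε : ℝ)
    (hh : h ∈ Set.Ioo (0 : ℝ) 1) (hε : ε ∈ Set.Ioo (0 : ℝ) 1)
    (hε2 : ε ≤ 1 / 2)
    (V : Fin N → ℝ) (hV : ∀ k, |V k| < ε) (hmono : Monotone V) :
    ∀ k l : Fin N, ε < |V k - V l| → ε < |Phi h ε V k - Phi h ε V l| := by
  intro k l hkl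
  rw [Phi_eq_w hh hε.1 hε2 hV, Phi_eq_w hh hε.1 hε2 hV]
  unfold w
  rcases lt_abs.1 hkl with hlt | hlt
  · have := drift_le_drift hh.1.le hε.1.le hV hlt
    exact lt_abs.2 (Or.inl (by linarith))
  · rw [neg_sub] at hlt
    have := drift_le_drift hh.1.le hε.1.le hV hlt
    exact lt_abs.2 (Or.inr (by linarith))
end

section
/- Let V ∈ 𝒱 and let A ⊆ {1,…,N} be a nonempty set of indices such that J(V,k) = A for every k ∈ A and |w_k(V)| ≤ 1 for every k ∈ A. Then Σ_{k ∈ A} Φ(V)_k = (1 + h) · Σ_{k ∈ A} v_k; consequently, as long as this configuration persists along the trajectory, the sum over A is multiplied by (1+h) at each step. -/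
open Finset Filter

/-- let `V ∈ 𝒱` and let `A` be a nonempty set of indices such
that `J(V,k) = A` and `|w_k(V)| ≤ 1` for every `k ∈ A`. Then
`Σ_{k ∈ A} Φ(V)_k = (1 + h) · Σ_{k ∈ A} v_k`. -/
theorem statement14 (N : ℕ) (hN : 1 ≤ N) (h ε : ℝ)
    (hh : h ∈ Set.Ioo (0 : ℝ) 1) (hε : ε ∈ Set.Ioo (0 : ℝ) 1)
    (V : Fin N → ℝ) (hV : ∀ k, V k ∈ Set.Icc (-1 : ℝ) 1)
    (A : Finset (Fin N)) (hne : A.Nonempty)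
    (hJ : ∀ k ∈ A, J ε V k = A) (hw : ∀ k ∈ A, |w h ε V k| ≤ 1) :
    ∑ k ∈ A, Phi h ε V k = (1 + h) * ∑ k ∈ A, V k := by
  have hcard : (A.card : ℝ) ≠ 0 := by exact_mod_cast hne.card_ne_zero
  have hPhi : ∀ k ∈ A, Phi h ε V k = V k + h / A.card * ∑ l ∈ A, V l := by
    intro k hk
    obtain ⟨hlo, hhi⟩ := abs_le.mp (hw k hk)
    rw [Phi, min_eq_right hhi, max_eq_right hlo, w, hJ k hk]
  rw [sum_congr rfl hPhi, sum_add_distrib, sum_const, nsmul_eq_mul]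
  field_simp
end

section
/- For every V^0 ∈ 𝒱 the sets of extreme components stabilize: there exists n_1 ≥ 0 such that for all n ≥ n_1, {k : (Φ^n(V^0))_k = 1} = {k : (Φ^{n_1}(V^0))_k = 1} and {k : (Φ^n(V^0))_k = −1} = {k : (Φ^{n_1}(V^0))_k = −1}. -/
open Finset Filter

/-- If a property of a component survives every application of `f`, then the set of components
of the iterates of `f` having this property is eventually constant. -/
theorem exists_iterate_setOf_eq {ι α : Type*} [Finite ι] (f : (ι → α) → ι → α) (a : α)
    (hf : ∀ V k, V k = a → f V k = a) (V : ι → α) :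
    ∃ m : ℕ, ∀ n ≥ m, {k | (f^[n] V) k = a} = {k | (f^[m] V) k = a} := by
  have hmono : Monotone fun n : ℕ => {k | (f^[n] V) k = a} := by
    refine monotone_nat_of_le_succ fun n k hk => ?_
    rw [Set.mem_ofPred_eq, Function.iterate_succ_apply']
    exact hf _ k hk
  obtain ⟨m, hm⟩ := WellFoundedGT.monotone_chain_condition ⟨_, hmono⟩
  exact ⟨m, fun n hn => (hm n hn).symm⟩

/-- for every `V⁰ ∈ 𝒱` the sets of extreme components
stabilize: there exists `n₁` such that for all `n ≥ n₁` the set of indices with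
value `1` (resp. `−1`) in `Φⁿ(V⁰)` coincides with that of `Φ^{n₁}(V⁰)`. -/
theorem statement15 (N : ℕ) (hN : 1 ≤ N) (h ε : ℝ)
    (hh : h ∈ Set.Ioo (0 : ℝ) 1) (hε : ε ∈ Set.Ioo (0 : ℝ) 1)
    (V0 : Fin N → ℝ) (hV0 : ∀ k, V0 k ∈ Set.Icc (-1 : ℝ) 1) :
    ∃ n1 : ℕ, ∀ n ≥ n1,
      {k : Fin N | ((Phi h ε)^[n] V0) k = 1} =
        {k : Fin N | ((Phi h ε)^[n1] V0) k = 1} ∧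
      {k : Fin N | ((Phi h ε)^[n] V0) k = -1} =
        {k : Fin N | ((Phi h ε)^[n1] V0) k = -1} := by
  obtain ⟨a, ha⟩ := exists_iterate_setOf_eq (Phi h ε) 1
    (fun _ _ => Phi_eq_one hh.1.le hε.2.le) V0
  obtain ⟨b, hb⟩ := exists_iterate_setOf_eq (Phi h ε) (-1)
    (fun _ _ => Phi_eq_neg_one hh.1.le hε.2.le) V0
  refine ⟨max a b, fun n hn => ⟨?_, ?_⟩⟩
  · rw [ha n (le_of_max_le_left hn), ha _ (le_max_left a b)]
  · rw [hb n (le_of_max_le_right hn), hb _ (le_max_right a b)]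
end

section
/- Let A be an N×N real matrix all of whose complex eigenvalues are real and strictly positive. If V^0 ∈ ℝ^N is such that the sequence V^n = A^n V^0 is bounded, then V^n converges as n → ∞ to a vector W ∈ ℝ^N satisfying A·W = W. (Equivalently, V^0 can be written as W_1 + W_2 with A·W_1 = W_1 and A^n·W_2 → 0.) -/
/-- The sequence `u` converges at a geometric rate. -/
def ConvergesGeometrically {E : Type*} [NormedAddCommGroup E] (u : ℕ → E) : Prop :=
  ∃ (L : E) (C r : ℝ), 0 ≤ r ∧ r < 1 ∧ ∀ n, ‖u n - L‖ ≤ C * r ^ n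

theorem ConvergesGeometrically.exists_tendsto {E : Type*} [NormedAddCommGroup E] {u : ℕ → E}
    (hu : ConvergesGeometrically u) : ∃ L, Filter.Tendsto u Filter.atTop (nhds L) := by
  obtain ⟨L, C, r, hr0, hr1, h⟩ := hu
  refine ⟨L, tendsto_iff_norm_sub_tendsto_zero.2 ?_⟩
  refine squeeze_zero (fun _ => norm_nonneg _) h ?_
  simpa using (tendsto_pow_atTop_nhds_zero_of_lt_one hr0 hr1).const_mul C

/-- A perturbed contracting scalar recursion with geometrically decaying error decays
geometrically. -/
theorem exists_le_geometric_of_le_mul_add {d : ℕ → ℝ} {a C r : ℝ} (ha0 : 0 ≤ a) (ha1 : a < 1)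
    (hr0 : 0 ≤ r) (hr1 : r < 1) (hC : 0 ≤ C) (h : ∀ n, d (n + 1) ≤ a * d n + C * r ^ n) :
    ∃ K s : ℝ, 0 ≤ s ∧ s < 1 ∧ ∀ n, d n ≤ K * s ^ n := by
  obtain ⟨s, hs, hs1⟩ := exists_between (max_lt ha1 hr1)
  obtain ⟨has, hrs⟩ := max_lt_iff.1 hs
  have hs0 : 0 ≤ s := ha0.trans has.le
  have hpos : 0 < s - a := sub_pos.2 has
  refine ⟨max (d 0) (C / (s - a)), s, hs0, hs1, fun n => ?_⟩
  have hK : C ≤ max (d 0) (C / (s - a)) * (s - a) := (div_le_iff₀ hpos).1 (le_max_right _ _)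
  induction n with
  | zero => simp
  | succ n ih =>
    have h1 : r ^ n ≤ s ^ n := pow_le_pow_left₀ hr0 hrs.le n
    have h2 : 0 ≤ s ^ n := pow_nonneg hs0 n
    calc d (n + 1) ≤ a * d n + C * r ^ n := h n
      _ ≤ a * (max (d 0) (C / (s - a)) * s ^ n)
          + max (d 0) (C / (s - a)) * (s - a) * s ^ n := by gcongr
      _ = max (d 0) (C / (s - a)) * s ^ (n + 1) := by ring

/-- A bounded solution of a perturbed expanding scalar recursion with geometrically decaying error
decays geometrically. -/
theorem le_geometric_of_mul_le_add {d : ℕ → ℝ} {a C r M : ℝ} (ha : 1 < a)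
    (hr0 : 0 ≤ r) (hr1 : r < 1) (hC : 0 ≤ C) (hM : ∀ n, d n ≤ M)
    (h : ∀ n, a * d n ≤ d (n + 1) + C * r ^ n) (n : ℕ) :
    d n ≤ C / (a - r) * r ^ n := by
  have hpos : 0 < a - r := by linarith
  have hstep : ∀ k m, a ^ k * (d m - C / (a - r) * r ^ m) ≤ M := by
    intro k
    induction k with
    | zero =>
      intro m
      have : 0 ≤ C / (a - r) * r ^ m := by positivity
      simpa using (sub_le_self _ this).trans (hM m)
    | succ k ih =>
      intro m
      refine le_trans ?_ (ih (m + 1))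
      rw [pow_succ, mul_assoc]
      refine mul_le_mul_of_nonneg_left ?_ (by positivity)
      have hC' : C * r ^ m = C / (a - r) * (a - r) * r ^ m := by
        rw [div_mul_cancel₀ _ hpos.ne']
      have := h m
      rw [pow_succ]
      linarith
  by_contra! hlt
  have hb : 0 < d n - C / (a - r) * r ^ n := sub_pos.2 hlt
  obtain ⟨k, hk⟩ :=
    ((tendsto_pow_atTop_atTop_of_one_lt ha).eventually_gt_atTop
      (M / (d n - C / (a - r) * r ^ n))).exists
  exact absurd (hstep k n) (not_le.2 ((div_lt_iff₀ hb).1 hk))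

/-- A bounded sequence whose increments converge geometrically converges geometrically. -/
theorem ConvergesGeometrically.of_sub {E : Type*} [NormedAddCommGroup E] [NormedSpace ℝ E]
    [CompleteSpace E] {u : ℕ → E} {M : ℝ} (hM : ∀ n, ‖u n‖ ≤ M)
    (h : ConvergesGeometrically fun n => u (n + 1) - u n) : ConvergesGeometrically u := by
  obtain ⟨L, C, r, hr0, hr1, h⟩ := h
  have hd : ∀ n, dist (u n - (n : ℝ) • L) (u (n + 1) - ((n + 1 : ℕ) : ℝ) • L) ≤ C * r ^ n := by
    intro n
    rw [dist_comm, dist_eq_norm]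
    refine (congrArg norm ?_).trans_le (h n)
    push_cast
    module
  obtain ⟨P, hP⟩ := cauchySeq_tendsto_of_complete (cauchySeq_of_le_geometric r C hr1 hd)
  have hL : L = 0 := by
    obtain ⟨B, hB⟩ := hP.norm.bddAbove_range
    by_contra hne
    have hpos : 0 < ‖L‖ := norm_pos_iff.2 hne
    obtain ⟨n, hn⟩ := exists_nat_gt ((M + B) / ‖L‖)
    have h1 : ‖u n - (n : ℝ) • L‖ ≤ B := hB ⟨n, rfl⟩
    have h2 : ‖(n : ℝ) • L‖ ≤ ‖u n‖ + ‖u n - (n : ℝ) • L‖ := by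
      simpa using norm_sub_le (u n) (u n - (n : ℝ) • L)
    rw [norm_smul, Real.norm_natCast] at h2
    have h3 := (div_lt_iff₀ hpos).1 hn
    linarith [hM n]
  subst hL
  simp only [smul_zero, sub_zero] at hd hP
  refine ⟨P, C / (1 - r), r, hr0, hr1, fun n => ?_⟩
  rw [← dist_eq_norm, div_mul_eq_mul_div]
  exact dist_le_of_le_geometric_of_tendsto r C hr1 hd hP n

/-- If `u` is bounded and `u (n + 1) - μ u n` converges geometrically, where either `‖μ‖ ≠ 1` or
`μ = 1`, then `u` converges geometrically. -/
theorem ConvergesGeometrically.of_sub_smul {E : Type*} [NormedAddCommGroup E] [NormedSpace ℂ E]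
    [CompleteSpace E] {u : ℕ → E} {M : ℝ} {μ : ℂ} (hμ : ‖μ‖ = 1 → μ = 1) (hM : ∀ n, ‖u n‖ ≤ M)
    (h : ConvergesGeometrically fun n => u (n + 1) - μ • u n) : ConvergesGeometrically u := by
  by_cases h1 : μ = 1
  · subst h1
    let : NormedSpace ℝ E := NormedSpace.restrictScalars ℝ ℂ E
    exact .of_sub hM (by simpa using h)
  obtain ⟨W, C, r, hr0, hr1, h⟩ := h
  have hC : 0 ≤ C := by simpa using (norm_nonneg _).trans (h 0)
  have hne : 1 - μ ≠ 0 := sub_ne_zero.2 (Ne.symm h1)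
  set L : E := (1 - μ)⁻¹ • W with hL
  have hW : W = (1 - μ) • L := by rw [hL, smul_inv_smul₀ hne]
  have hrec : ∀ n, ‖(u (n + 1) - L) - μ • (u n - L)‖ ≤ C * r ^ n := by
    intro n
    convert h n using 2
    rw [hW]
    module
  rcases lt_or_gt_of_ne (fun he => h1 (hμ he)) with hlt | hgt
  · obtain ⟨K, s, hs0, hs1, hK⟩ := exists_le_geometric_of_le_mul_add (d := fun n => ‖u n - L‖)
      (norm_nonneg μ) hlt hr0 hr1 hC fun n => by
        have h2 := norm_sub_norm_le (u (n + 1) - L) (μ • (u n - L))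
        rw [norm_smul] at h2
        linarith [hrec n]
    exact ⟨L, K, s, hs0, hs1, hK⟩
  · refine ⟨L, C / (‖μ‖ - r), r, hr0, hr1,
      le_geometric_of_mul_le_add (d := fun n => ‖u n - L‖) (M := M + ‖L‖) hgt hr0 hr1 hC
        (fun n => (norm_sub_le _ _).trans (by linarith [hM n])) fun n => ?_⟩
    have h2 := norm_sub_norm_le (μ • (u n - L)) (u (n + 1) - L)
    rw [norm_smul, norm_sub_rev (μ • (u n - L))] at h2
    linarith [hrec n]

/-- A bounded orbit of a linear map, annihilated by a split polynomial whose only possible root of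
modulus one is `1`, converges geometrically. -/
theorem Module.End.convergesGeometrically_pow_apply {E : Type*} [NormedAddCommGroup E]
    [NormedSpace ℂ E] [CompleteSpace E] (f : Module.End ℂ E) (s : Multiset ℂ)
    (hs : ∀ μ ∈ s, ‖μ‖ = 1 → μ = 1) (v : E) {M : ℝ} (hM : ∀ n, ‖(f ^ n) v‖ ≤ M)
    (hv : Polynomial.aeval f (s.map fun μ => Polynomial.X - Polynomial.C μ).prod v = 0) :
    ConvergesGeometrically fun n => (f ^ n) v := by
  induction s using Multiset.induction_on generalizing v M with
  | empty =>
    have hv0 : v = 0 := by simpa using hv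
    exact ⟨0, 0, 0, le_rfl, one_pos, by simp [hv0]⟩
  | cons μ s ih =>
    have hstep : ∀ n, (f ^ n) (f v - μ • v) = (f ^ (n + 1)) v - μ • (f ^ n) v := by
      intro n
      rw [map_sub, map_smul, pow_succ, Module.End.mul_apply]
    refine .of_sub_smul (hs μ (Multiset.mem_cons_self μ s)) hM ?_
    simp only [← hstep]
    refine ih (fun ν hν => hs ν (Multiset.mem_cons_of_mem hν)) _ (M := M + ‖μ‖ * M)
      (fun n => ?_) ?_
    · rw [hstep]
      refine (norm_sub_le _ _).trans (add_le_add (hM _) ?_)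
      rw [norm_smul]
      exact mul_le_mul_of_nonneg_left (hM n) (norm_nonneg μ)
    · rw [Multiset.map_cons, Multiset.prod_cons, mul_comm, map_mul, Module.End.mul_apply] at hv
      simpa [Algebra.algebraMap_eq_smul_one] using hv

/-- let `A` be an `N×N` real matrix all of whose complex
eigenvalues are real and strictly positive. If `V⁰ ∈ ℝᴺ` is such that the
sequence `Vⁿ = Aⁿ V⁰` is bounded, then `Vⁿ` converges as `n → ∞` to a vector
`W` satisfying `A·W = W`. -/
theorem statement17 (N : ℕ) (A : Matrix (Fin N) (Fin N) ℝ)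
    (hA : ∀ μ : ℂ, μ ∈ spectrum ℂ (A.map (algebraMap ℝ ℂ)) → μ.im = 0 ∧ 0 < μ.re)
    (V0 : Fin N → ℝ)
    (hbdd : ∃ C : ℝ, ∀ n : ℕ, ‖(A ^ n).mulVec V0‖ ≤ C) :
    ∃ W : Fin N → ℝ, A.mulVec W = W ∧
      Filter.Tendsto (fun n : ℕ => (A ^ n).mulVec V0) Filter.atTop (nhds W) := by
  obtain ⟨C, hC⟩ := hbdd
  set B : Matrix (Fin N) (Fin N) ℂ := A.map (algebraMap ℝ ℂ)
  set f : Module.End ℂ (Fin N → ℂ) := Matrix.toLinAlgEquiv' B with hf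
  have horbit : ∀ n i, (f ^ n) (fun j => (V0 j : ℂ)) i = (((A ^ n).mulVec V0 i : ℝ) : ℂ) := by
    intro n i
    have hpow : B ^ n = (A ^ n).map (algebraMap ℝ ℂ) := (Matrix.map_pow A (algebraMap ℝ ℂ) n).symm
    rw [hf, ← map_pow, Matrix.toLinAlgEquiv'_apply, hpow]
    simp [Matrix.mulVec, dotProduct]
  have hroots : ∀ μ ∈ B.charpoly.roots, ‖μ‖ = 1 → μ = 1 := by
    intro μ hμ hnorm
    obtain ⟨him, hre⟩ := hA μ
      (Matrix.mem_spectrum_of_isRoot_charpoly (Polynomial.isRoot_of_mem_roots hμ))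
    have hμre : μ = (μ.re : ℂ) := Complex.ext rfl (by simpa using him)
    rw [hμre, Complex.norm_real, Real.norm_of_nonneg hre.le] at hnorm
    rw [hμre, hnorm, Complex.ofReal_one]
  have hann : Polynomial.aeval f
      (B.charpoly.roots.map fun μ => Polynomial.X - Polynomial.C μ).prod = 0 := by
    rw [← (IsAlgClosed.splits B.charpoly).eq_prod_roots_of_monic B.charpoly_monic, hf,
      Polynomial.aeval_algHom_apply, Matrix.aeval_self_charpoly, map_zero]
  have hbound : ∀ n, ‖(f ^ n) (fun j => (V0 j : ℂ))‖ ≤ C := by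
    intro n
    refine (pi_norm_le_iff_of_nonneg ((norm_nonneg _).trans (hC 0))).2 fun i => ?_
    rw [horbit, Complex.norm_real]
    exact (norm_le_pi_norm _ i).trans (hC n)
  obtain ⟨L, hL⟩ := (f.convergesGeometrically_pow_apply _ hroots _ hbound
    (by rw [hann, LinearMap.zero_apply])).exists_tendsto
  have hlim : Filter.Tendsto (fun n : ℕ => (A ^ n).mulVec V0) Filter.atTop
      (nhds fun i => (L i).re) := by
    refine tendsto_pi_nhds.2 fun i => ?_
    have := (Complex.continuous_re.tendsto _).comp (tendsto_pi_nhds.1 hL i)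
    simpa [Function.comp_def, horbit] using this
  refine ⟨_, ?_, hlim⟩
  have hcont : Continuous fun x => A.mulVec x :=
    Continuous.matrix_mulVec continuous_const continuous_id
  refine tendsto_nhds_unique ((hcont.tendsto _).comp hlim) ?_
  simpa [Function.comp_def, pow_succ', Matrix.mulVec_mulVec] using
    hlim.comp (Filter.tendsto_add_atTop_nat 1)
end
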